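/- arXiv:2512.23839 — 3 statements merged into one kernel-verified Lean document; each statement's English description precedes it below -/
import Mathlib

section
/- Let P be a prime ideal of ℬ[x], let a, m be positive integers with m > a, and suppose 1+x^a ∈ P while 1+x^m ∉ P and 1+x^{m−a} ∉ P. Then 1+x^a+x^m ∈ P or 1+x^{m−a}+x^m ∈ P. (This follows from the identity (1+x^a+x^m)(1+x^{m−a}+x^m) = (1+x^a)(1+x^m)(1+x^{m−a}) which holds in ℬ[x].) -/
/-- The Boolean semifield `𝔹 = {0, 1}` with `1 + 1 = 1`
    (addition is `∨`, multiplication is `∧`). -/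
def BoolSemiring : Type := Bool

namespace BoolSemiring

instance : Zero BoolSemiring := ⟨(false : Bool)⟩
instance : One BoolSemiring := ⟨(true : Bool)⟩
instance : Add BoolSemiring := ⟨fun a b => ((a : Bool) || (b : Bool) : Bool)⟩
instance : Mul BoolSemiring := ⟨fun a b => ((a : Bool) && (b : Bool) : Bool)⟩
instance : DecidableEq BoolSemiring := fun a b => instDecidableEqBool a b
instance : Fintype BoolSemiring := Bool.fintype

instance : CommSemiring BoolSemiring where
  add_assoc := by decide
  zero_add := by decide
  add_zero := by decide
  add_comm := by decide
  mul_assoc := by decide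
  one_mul := by decide
  mul_one := by decide
  zero_mul := by decide
  mul_zero := by decide
  left_distrib := by decide
  right_distrib := by decide
  mul_comm := by decide
  nsmul := nsmulRec

end BoolSemiring

notation "𝔹" => BoolSemiring

open Polynomial

theorem BoolSemiring.polynomial_add_self (f : Polynomial 𝔹) : f + f = f := by
  ext n
  rw [coeff_add]
  generalize f.coeff n = c
  revert c
  decide

theorem BoolSemiring.polynomial_mul_identity (u v : Polynomial 𝔹) :
    (1 + u + u * v) * (1 + v + u * v) = (1 + u) * (1 + u * v) * (1 + v) := by
  calc (1 + u + u * v) * (1 + v + u * v)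
      = 1 + u + v + u ^ 2 * v + u * v ^ 2 + u ^ 2 * v ^ 2 + u * v + (u * v + u * v) := by ring
    _ = 1 + u + v + u ^ 2 * v + u * v ^ 2 + u ^ 2 * v ^ 2 + u * v + u * v := by
      rw [polynomial_add_self (u * v)]
    _ = (1 + u) * (1 + u * v) * (1 + v) := by ring

theorem stmt_2 (P : Ideal (Polynomial 𝔹)) (hP : P.IsPrime)
    (a m : ℕ) (ha : 0 < a) (ham : a < m)
    (h1 : (1 : Polynomial 𝔹) + X ^ a ∈ P)
    (h2 : (1 : Polynomial 𝔹) + X ^ m ∉ P)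
    (h3 : (1 : Polynomial 𝔹) + X ^ (m - a) ∉ P) :
    (1 : Polynomial 𝔹) + X ^ a + X ^ m ∈ P ∨
      (1 : Polynomial 𝔹) + X ^ (m - a) + X ^ m ∈ P := by
  have hm : (X : Polynomial 𝔹) ^ m = X ^ a * X ^ (m - a) := by
    rw [← pow_add, Nat.add_sub_cancel' ham.le]
  apply hP.mem_or_mem
  rw [hm, BoolSemiring.polynomial_mul_identity, mul_assoc]
  exact P.mul_mem_right _ h1
end

section
/- Let a ≥ 1, α > a, and m be integers with α ≤ m < α + a, and set q = mα + Σ_{i=1}^{α−1}(α+i). Then in ℬ[x] one has the identity (1+x^{m−a}) · (1+x^α)^m · ∏_{i=1}^{α−1}(1+x^{α+i}) = 1 + x^{m−a} + Σ_{j=α}^{q−α+m−a} x^j + x^q + x^{q+m−a}. -/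
open Polynomial


namespace BoolSemiring

lemma add_ne_zero_iff : ∀ {a b : 𝔹}, a + b ≠ 0 ↔ a ≠ 0 ∨ b ≠ 0 := by decide

lemma mul_ne_zero_iff' : ∀ {a b : 𝔹}, a * b ≠ 0 ↔ a ≠ 0 ∧ b ≠ 0 := by decide

lemma eq_of_ne_zero_iff : ∀ {a b : 𝔹}, (a ≠ 0 ↔ b ≠ 0) → a = b := by decide

lemma one_ne_zero' : (1 : 𝔹) ≠ 0 := by decide

lemma sum_ne_zero_iff {ι : Type*} (s : Finset ι) (f : ι → 𝔹) :
    ∑ i ∈ s, f i ≠ 0 ↔ ∃ i ∈ s, f i ≠ 0 := by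
  classical
  induction s using Finset.induction_on with
  | empty => simp
  | insert i s hi ih => rw [Finset.sum_insert hi, add_ne_zero_iff, ih]; simp

lemma coeff_mul_ne_zero_iff (p r : Polynomial 𝔹) (n : ℕ) :
    (p * r).coeff n ≠ 0 ↔ ∃ i j, i + j = n ∧ p.coeff i ≠ 0 ∧ r.coeff j ≠ 0 := by
  simp [Polynomial.coeff_mul, sum_ne_zero_iff, mul_ne_zero_iff']

lemma coeff_X_pow_ne_zero_iff (k n : ℕ) : ((X : Polynomial 𝔹) ^ k).coeff n ≠ 0 ↔ n = k := by
  rw [coeff_X_pow]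
  split_ifs with h <;> simp [h, one_ne_zero']

lemma coeff_one_ne_zero_iff (n : ℕ) : (1 : Polynomial 𝔹).coeff n ≠ 0 ↔ n = 0 := by
  simpa using coeff_X_pow_ne_zero_iff 0 n

lemma coeff_one_add_X_pow_ne_zero_iff (k n : ℕ) :
    ((1 : Polynomial 𝔹) + X ^ k).coeff n ≠ 0 ↔ n = 0 ∨ n = k := by
  rw [coeff_add, add_ne_zero_iff, coeff_one_ne_zero_iff, coeff_X_pow_ne_zero_iff]

lemma coeff_one_add_X_pow_pow_ne_zero_iff (k m n : ℕ) :
    (((1 : Polynomial 𝔹) + X ^ k) ^ m).coeff n ≠ 0 ↔ ∃ j ≤ m, n = j * k := by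
  induction m generalizing n with
  | zero => simp [coeff_one_ne_zero_iff, -ne_eq]
  | succ m ih =>
    rw [pow_succ, coeff_mul_ne_zero_iff]
    simp only [ih, coeff_one_add_X_pow_ne_zero_iff]
    constructor
    · rintro ⟨_, _, rfl, ⟨j, hj, rfl⟩, rfl | rfl⟩
      · exact ⟨j, by omega, by simp⟩
      · exact ⟨j + 1, by omega, by ring⟩
    · rintro ⟨j, hj, rfl⟩
      rcases j with _ | j
      · exact ⟨0, 0, by simp, ⟨0, by simp⟩, Or.inl rfl⟩
      · exact ⟨j * k, k, by ring, ⟨j, by omega, rfl⟩, Or.inr rfl⟩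

lemma coeff_prod_one_add_X_pow_ne_zero_iff {ι : Type*} (s : Finset ι) (f : ι → ℕ) (n : ℕ) :
    (∏ i ∈ s, ((1 : Polynomial 𝔹) + X ^ f i)).coeff n ≠ 0 ↔ ∃ A ⊆ s, n = ∑ i ∈ A, f i := by
  classical
  rw [Finset.prod_one_add, finsetSum_coeff, sum_ne_zero_iff]
  simp only [Finset.prod_pow_eq_pow_sum, coeff_X_pow_ne_zero_iff, Finset.mem_powerset]

end BoolSemiring

lemma exists_subset_Icc_sum_eq (k s : ℕ) (hs : s ≤ ∑ i ∈ Finset.Icc 1 k, i) :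
    ∃ A ⊆ Finset.Icc 1 k, ∑ i ∈ A, i = s := by
  induction k generalizing s with
  | zero => exact ⟨∅, by simp, by simp at hs; simp [hs]⟩
  | succ k ih =>
    rw [Finset.sum_Icc_succ_top (by omega)] at hs
    have hsub : Finset.Icc 1 k ⊆ Finset.Icc 1 (k + 1) :=
      Finset.Icc_subset_Icc_right (by omega)
    by_cases h : s ≤ ∑ i ∈ Finset.Icc 1 k, i
    · obtain ⟨A, hA, rfl⟩ := ih s h
      exact ⟨A, hA.trans hsub, rfl⟩
    · have hk : k ≤ ∑ i ∈ Finset.Icc 1 k, i := by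
        rcases k with _ | k
        · simp
        · exact Finset.single_le_sum (f := fun i => i) (by simp) (by simp)
      obtain ⟨A, hA, hAs⟩ := ih (s - (k + 1)) (by omega)
      have hmem : k + 1 ∉ A := fun hm => by simpa using hA hm
      refine ⟨insert (k + 1) A, Finset.insert_subset (by simp) (hA.trans hsub), ?_⟩
      rw [Finset.sum_insert hmem, hAs]
      omega

lemma exists_mul_add_sum_eq {α m n T : ℕ} (hα : 2 ≤ α) (hm : α ≤ m)
    (hT : T = ∑ i ∈ Finset.Icc 1 (α - 1), i)
    (hn : α ≤ n) (hn' : n + α ≤ (m + (α - 1)) * α + T) :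
    ∃ j ≤ m, ∃ A ⊆ Finset.Icc 1 (α - 1), n = j * α + (A.card * α + ∑ i ∈ A, i) := by
  classical
  have hTle : α - 1 ≤ T := by
    rw [hT]
    exact Finset.single_le_sum (f := fun i => i) (by simp) (by simp; omega)
  have hcard : ∀ A ⊆ Finset.Icc 1 (α - 1), A.card * α + α ≤ m * α := fun A hA => by
    have := Finset.card_le_card hA
    simp only [Nat.card_Icc] at this
    calc A.card * α + α = (A.card + 1) * α := by ring
      _ ≤ m * α := Nat.mul_le_mul_right _ (by omega)
  -- `n` is reached from `A` once it lies in the right range and residue class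
  have reach : ∀ u v, n = u * α + v → ∀ A ⊆ Finset.Icc 1 (α - 1), ∑ i ∈ A, i = v →
      A.card * α + v ≤ n → n ≤ m * α + (A.card * α + v) →
      ∃ j ≤ m, ∃ A ⊆ Finset.Icc 1 (α - 1), n = j * α + (A.card * α + ∑ i ∈ A, i) := by
    intro u v huv A hA hAv hle hge
    have h₁ : A.card ≤ u := Nat.le_of_mul_le_mul_right (by omega) (by omega : 0 < α)
    have h₂ : u ≤ m + A.card :=
      Nat.le_of_mul_le_mul_right (by rw [add_mul]; omega) (by omega : 0 < α)
    refine ⟨u - A.card, by omega, A, hA, ?_⟩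
    obtain ⟨d, rfl⟩ := Nat.exists_eq_add_of_le h₁
    rw [hAv, huv, Nat.add_sub_cancel_left]
    ring
  -- climb through the admissible excesses `v` in the residue class of `n`
  by_contra hcon
  have key : ∀ k, n % α + k * α ≤ T → ∃ A ⊆ Finset.Icc 1 (α - 1),
      ∑ i ∈ A, i = n % α + k * α ∧ A.card * α + (n % α + k * α) ≤ n := by
    intro k
    induction k with
    | zero =>
      intro _
      have hlt := Nat.mod_lt n (by omega : 0 < α)
      have hdm := Nat.mod_add_div n α
      have hdiv : α ≤ α * (n / α) := Nat.le_mul_of_pos_right _ (Nat.div_pos hn (by omega))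
      by_cases h0 : n % α = 0
      · exact ⟨∅, by simp, by simp [h0], by simp [h0]⟩
      · exact ⟨{n % α}, by simp; omega, by simp, by simp; omega⟩
    | succ k ih =>
      intro hk
      rw [add_mul, one_mul] at hk ⊢
      obtain ⟨A, hA, hAs, hle⟩ := ih (by omega)
      obtain ⟨B, hB, hBs⟩ := exists_subset_Icc_sum_eq (α - 1) (n % α + (k * α + α)) (hT ▸ hk)
      refine ⟨B, hB, hBs, ?_⟩
      by_contra hlt
      have hBc := hcard B hB
      have hkn : k ≤ n / α := by
        rw [Nat.le_div_iff_mul_le (by omega)]; omega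
      refine hcon (reach (n / α - k) (n % α + k * α) ?_ A hA hAs hle (by omega))
      have hdm := Nat.div_add_mod' n α
      obtain ⟨d, hd⟩ := Nat.exists_eq_add_of_le hkn
      rw [hd, Nat.add_sub_cancel_left]
      rw [hd, add_mul] at hdm
      omega
  set k := (T - n % α) / α with hkdef
  have hlt := Nat.mod_lt n (by omega : 0 < α)
  have hdm := Nat.div_add_mod' (T - n % α) α
  have hlt' := Nat.mod_lt (T - n % α) (by omega : 0 < α)
  rw [← hkdef] at hdm
  obtain ⟨A, hA, hAs, hle⟩ := key k (by omega)
  have hdn := Nat.div_add_mod' n α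
  have hkn : k ≤ n / α := by
    rw [Nat.le_div_iff_mul_le (by omega)]; omega
  obtain ⟨d, hd⟩ := Nat.exists_eq_add_of_le hkn
  rw [hd, add_mul] at hdn
  have hnd : n = d * α + (n % α + k * α) := by omega
  set r := (T - n % α) % α with hr
  have hT' : T = n % α + k * α + r := by omega
  have hfar : m * α + (A.card * α + (n % α + k * α)) < n := by
    by_contra h
    exact hcon (reach d _ hnd A hA hAs hle (by omega))
  -- the complement of the residual excess `r` in `{1, …, α - 1}` reaches `n`
  by_cases h0 : r = 0
  · have hc := hcard _ (Finset.Subset.refl (Finset.Icc 1 (α - 1)))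
    refine hcon (reach d _ hnd (Finset.Icc 1 (α - 1)) subset_rfl (by omega) (by omega) ?_)
    rw [Nat.card_Icc, Nat.add_sub_cancel]
    rw [add_mul] at hn'
    omega
  · have hmem : r ∈ Finset.Icc 1 (α - 1) := by simp; omega
    have hs := Finset.add_sum_erase _ (fun i => i) hmem
    have hcd : ((Finset.Icc 1 (α - 1)).erase r).card = α - 2 := by
      rw [Finset.card_erase_of_mem hmem, Nat.card_Icc]; omega
    have hc := hcard _ (Finset.erase_subset r (Finset.Icc 1 (α - 1)))
    refine hcon (reach d _ hnd _ (Finset.erase_subset r _) (by omega)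
      (by omega) ?_)
    rw [hcd]
    have h₁ : d * α < (m + (α - 2) + 1) * α := by
      have : (m + (α - 2) + 1) * α = (m + (α - 1)) * α := by congr 1; omega
      omega
    have h₂ : d ≤ m + (α - 2) := Nat.lt_succ_iff.mp (Nat.lt_of_mul_lt_mul_right h₁)
    have h₃ := Nat.mul_le_mul_right α h₂
    rw [add_mul] at h₃
    omega

lemma exists_mul_add_sum_iff {α m n q : ℕ} (hα : 2 ≤ α) (hm : α ≤ m)
    (hq : q = m * α + ∑ i ∈ Finset.Icc 1 (α - 1), (α + i)) :
    (∃ j ≤ m, ∃ A ⊆ Finset.Icc 1 (α - 1), n = j * α + ∑ i ∈ A, (α + i)) ↔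
      n = 0 ∨ (α ≤ n ∧ n + α ≤ q) ∨ n = q := by
  classical
  have hlow : ∀ j, ∀ A : Finset ℕ, j * α + ∑ i ∈ A, (α + i) = 0 ∨
      α ≤ j * α + ∑ i ∈ A, (α + i) := by
    intro j A
    rcases Nat.eq_zero_or_pos j with rfl | hj
    · rcases A.eq_empty_or_nonempty with rfl | ⟨i, hi⟩
      · simp
      · have := Finset.single_le_sum (f := fun i => α + i) (by simp) hi
        omega
    · have := Nat.le_mul_of_pos_left α hj
      omega
  constructor
  · rintro ⟨j, hj, A, hA, rfl⟩
    have hsum := Finset.sum_sdiff (f := fun i => α + i) hA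
    have hmul : (m - j) * α + j * α = m * α := by rw [← add_mul, Nat.sub_add_cancel hj]
    have h₁ := hlow j A
    have h₂ := hlow (m - j) (Finset.Icc 1 (α - 1) \ A)
    omega
  · rintro (rfl | ⟨h₁, h₂⟩ | rfl)
    · exact ⟨0, by simp, ∅, by simp, by simp⟩
    · have hsplit (A : Finset ℕ) : ∑ i ∈ A, (α + i) = A.card * α + ∑ i ∈ A, i := by
        rw [Finset.sum_add_distrib, Finset.sum_const, smul_eq_mul]
      simp only [hsplit] at hq ⊢
      refine exists_mul_add_sum_eq hα hm rfl h₁ (h₂.trans_eq ?_)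
      rw [hq, Nat.card_Icc, Nat.add_sub_cancel]
      ring
    · exact ⟨m, le_rfl, _, subset_rfl, hq⟩

theorem stmt_5 (a α m q : ℕ) (ha : 1 ≤ a) (haα : a < α)
    (h1 : α ≤ m) (h2 : m < α + a)
    (hq : q = m * α + ∑ i ∈ Finset.Icc 1 (α - 1), (α + i)) :
    ((1 : Polynomial 𝔹) + X ^ (m - a)) * ((1 : Polynomial 𝔹) + X ^ α) ^ m *
        ∏ i ∈ Finset.Icc 1 (α - 1), ((1 : Polynomial 𝔹) + X ^ (α + i)) =
      1 + X ^ (m - a) + (∑ j ∈ Finset.Icc α (q - α + m - a), (X : Polynomial 𝔹) ^ j)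
        + X ^ q + X ^ (q + m - a) := by
  have hlarge : 3 * α ≤ q := by
    have h₁ : α ≤ ∑ i ∈ Finset.Icc 1 (α - 1), (α + i) :=
      (Nat.le_add_right α 1).trans
        (Finset.single_le_sum (f := fun i => α + i) (by simp) (by simp; omega))
    have h₂ : 2 * α ≤ m * α := Nat.mul_le_mul_right α (by omega)
    omega
  ext n
  apply BoolSemiring.eq_of_ne_zero_iff
  have hmid (k : ℕ) : (((1 : Polynomial 𝔹) + X ^ α) ^ m *
      ∏ i ∈ Finset.Icc 1 (α - 1), ((1 : Polynomial 𝔹) + X ^ (α + i))).coeff k ≠ 0 ↔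
      k = 0 ∨ (α ≤ k ∧ k + α ≤ q) ∨ k = q := by
    rw [← exists_mul_add_sum_iff (by omega) h1 hq, BoolSemiring.coeff_mul_ne_zero_iff]
    simp only [BoolSemiring.coeff_one_add_X_pow_pow_ne_zero_iff,
      BoolSemiring.coeff_prod_one_add_X_pow_ne_zero_iff]
    constructor
    · rintro ⟨_, _, rfl, ⟨j, hj, rfl⟩, A, hA, rfl⟩
      exact ⟨j, hj, A, hA, rfl⟩
    · rintro ⟨j, hj, A, hA, rfl⟩
      exact ⟨_, _, rfl, ⟨j, hj, rfl⟩, A, hA, rfl⟩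
  rw [mul_assoc, BoolSemiring.coeff_mul_ne_zero_iff]
  simp only [hmid, coeff_add, finsetSum_coeff, BoolSemiring.add_ne_zero_iff,
    BoolSemiring.sum_ne_zero_iff, BoolSemiring.coeff_X_pow_ne_zero_iff,
    BoolSemiring.coeff_one_ne_zero_iff, Finset.mem_Icc, exists_eq_right']
  constructor
  · rintro ⟨i, k, rfl, hi, hk⟩
    omega
  · intro h
    by_cases h₀ : n = 0 ∨ (α ≤ n ∧ n + α ≤ q) ∨ n = q
    · exact ⟨0, n, by omega, by omega, h₀⟩
    · exact ⟨m - a, n - (m - a), by omega, by omega, by omega⟩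
end

section
/- Let J be a prime ideal of ℬ[x] with x ∉ J, let 𝔄_J = {a ≥ 1 : 1+x^a ∈ J}, and suppose the complement ℕ₊ \ 𝔄_J is nonempty with greatest common divisor d > 1 (i.e., d = gcd of all positive integers n with 1+x^n ∉ J). Then there exists a positive integer A such that for every a ∈ 𝔄_J with a > A one has: 1+x^a+x^m ∈ J for every m ≥ 1, and 1+x^{m−a}+x^m ∈ J for every m > a. -/
open Polynomial

/-- The set `𝔄_J = {a ≥ 1 : 1 + x^a ∈ J}` associated to an ideal `J` of `𝔹[x]`. -/
def AJ (J : Ideal (Polynomial 𝔹)) : Set ℕ :=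
  {a : ℕ | 1 ≤ a ∧ (1 : Polynomial 𝔹) + X ^ a ∈ J}

section Idempotent

variable {R : Type*} [CommSemiring R]

theorem sum_add_eq_right_of_forall {ι : Type*} {s : Finset ι} {f : ι → R} {b : R}
    (h : ∀ i ∈ s, f i + b = b) : ∑ i ∈ s, f i + b = b := by
  classical
  induction s using Finset.induction_on with
  | empty => simp
  | insert i s his ih =>
    rw [Finset.sum_insert his, add_assoc, ih fun j hj => h j (Finset.mem_insert_of_mem hj),
      h i (Finset.mem_insert_self i s)]

theorem add_sum_eq_sum_of_mem {ι : Type*} {s : Finset ι} {f : ι → R} {i : ι}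
    (h : (1 : R) + 1 = 1) (hi : i ∈ s) : f i + ∑ j ∈ s, f j = ∑ j ∈ s, f j := by
  classical
  have hf : f i + f i = f i := by rw [← mul_one (f i), ← mul_add, h]
  rw [← Finset.add_sum_erase s f hi, ← add_assoc, hf]

theorem one_add_pow_eq_sum_range (h : (1 : R) + 1 = 1) (u : R) (k : ℕ) :
    (1 + u) ^ k = ∑ i ∈ Finset.range (k + 1), u ^ i := by
  induction k with
  | zero => simp
  | succ k ih =>
    have key : ∑ i ∈ Finset.range k, u ^ (i + 1) + ∑ i ∈ Finset.range (k + 1), u ^ i =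
        ∑ i ∈ Finset.range (k + 1), u ^ i :=
      sum_add_eq_right_of_forall fun i hi =>
        add_sum_eq_sum_of_mem (f := fun i => u ^ i) h (by simpa using hi)
    rw [pow_succ, ih, mul_add, mul_one, Finset.sum_mul, Finset.sum_range_succ _ (k + 1)]
    simp only [← pow_succ]
    rw [Finset.sum_range_succ (fun i => u ^ (i + 1)), ← add_assoc, add_comm (∑ i ∈ _, u ^ i), key]

theorem one_add_pow_mul_one_add_pow_mul_add (h : (1 : R) + 1 = 1) {u v : R} {m n : ℕ}
    (hm : 1 ≤ m) (huv : u ^ m = v ^ n) :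
    (1 + u) ^ m * (1 + v) ^ n * u + (1 + u) ^ m * (1 + v) ^ n * (1 + u * v) =
      (1 + u) ^ m * (1 + v) ^ n * (1 + u * v) := by
  set s := Finset.range (m + 1) ×ˢ Finset.range (n + 1) with hs
  have hP : (1 + u) ^ m * (1 + v) ^ n = ∑ p ∈ s, u ^ p.1 * v ^ p.2 := by
    rw [one_add_pow_eq_sum_range h, one_add_pow_eq_sum_range h, Finset.sum_mul_sum,
      ← Finset.sum_product']
  have absorb (i j : ℕ) (hi : i ≤ m) (hj : j ≤ n) :
      u ^ i * v ^ j + ∑ p ∈ s, u ^ p.1 * v ^ p.2 = ∑ p ∈ s, u ^ p.1 * v ^ p.2 :=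
    add_sum_eq_sum_of_mem (f := fun p : ℕ × ℕ => u ^ p.1 * v ^ p.2) (i := (i, j)) h
      (by simp only [hs, Finset.mem_product, Finset.mem_range]; omega)
  rw [hP]
  set P := ∑ p ∈ s, u ^ p.1 * v ^ p.2
  rw [show P * u = ∑ p ∈ s, u ^ p.1 * v ^ p.2 * u from Finset.sum_mul _ _ _, mul_add, mul_one]
  refine sum_add_eq_right_of_forall fun ⟨i, j⟩ hij => ?_
  simp only [hs, Finset.mem_product, Finset.mem_range] at hij
  rcases Nat.lt_or_ge i m with hi | hi
  · rw [← add_assoc, show u ^ i * v ^ j * u = u ^ (i + 1) * v ^ j by ring,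
      absorb _ _ (by omega) (by omega)]
  · obtain rfl : i = m := by omega
    rcases j with _ | j
    · rw [← add_assoc, show u ^ i * v ^ 0 * u = u ^ 1 * v ^ n by rw [huv]; ring,
        absorb _ _ hm le_rfl]
    · have := congrArg (· * (u * v)) (absorb i j le_rfl (by omega))
      simp only [add_mul] at this
      rw [add_left_comm, show u ^ i * v ^ (j + 1) * u = u ^ i * v ^ j * (u * v) by ring, this]

theorem one_add_pow_mul_one_add_pow_mul_one_add_mul (h : (1 : R) + 1 = 1) {u v : R} {m n : ℕ}
    (hm : 1 ≤ m) (hn : 1 ≤ n) (huv : u ^ m = v ^ n) :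
    (1 + u) ^ m * (1 + v) ^ n * (1 + u * v) = (1 + u) ^ (m + 1) * (1 + v) ^ (n + 1) := by
  have h1 := one_add_pow_mul_one_add_pow_mul_add h hm huv
  have h2 := one_add_pow_mul_one_add_pow_mul_add h hn huv.symm
  rw [mul_comm ((1 + v) ^ n), mul_comm v] at h2
  calc (1 + u) ^ m * (1 + v) ^ n * (1 + u * v)
      = (1 + u) ^ m * (1 + v) ^ n * u + ((1 + u) ^ m * (1 + v) ^ n * v +
          (1 + u) ^ m * (1 + v) ^ n * (1 + u * v)) := by rw [h2, h1]
    _ = (1 + u) ^ (m + 1) * (1 + v) ^ (n + 1) := by ring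

end Idempotent

theorem one_add_one_polynomial_boolSemiring : (1 : Polynomial 𝔹) + 1 = 1 := by
  rw [← C_1, ← C_add]
  congr 1

theorem one_add_X_pow_add_notMem {J : Ideal (Polynomial 𝔹)} (hJ : J.IsPrime) {n m : ℕ}
    (hn : 1 ≤ n) (hm : 1 ≤ m) (hnJ : (1 : Polynomial 𝔹) + X ^ n ∉ J)
    (hmJ : (1 : Polynomial 𝔹) + X ^ m ∉ J) : (1 : Polynomial 𝔹) + X ^ (n + m) ∉ J := by
  intro hmem
  have key := one_add_pow_mul_one_add_pow_mul_one_add_mul one_add_one_polynomial_boolSemiring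
    (u := X ^ n) (v := X ^ m) hm hn (by rw [← pow_mul, ← pow_mul, mul_comm])
  rw [← pow_add] at key
  rcases hJ.mem_or_mem (key ▸ J.mul_mem_left _ hmem) with h | h
  · exact hnJ (hJ.mem_of_pow_mem _ h)
  · exact hmJ (hJ.mem_of_pow_mem _ h)

theorem one_add_X_pow_notMem_of_mem_closure {J : Ideal (Polynomial 𝔹)} (hJ : J.IsPrime) {a : ℕ}
    (ha : a ∈ AddSubmonoid.closure {n : ℕ | 1 ≤ n ∧ (1 : Polynomial 𝔹) + X ^ n ∉ J}) :
    (1 : Polynomial 𝔹) + X ^ a ∉ J := by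
  have h0 : (1 : Polynomial 𝔹) + X ^ 0 ∉ J := by
    rw [pow_zero, one_add_one_polynomial_boolSemiring]
    exact J.ne_top_iff_one.mp hJ.ne_top
  induction ha using AddSubmonoid.closure_induction with
  | mem n hn => exact hn.2
  | zero => exact h0
  | add n m _ _ ihn ihm =>
    rcases n.eq_zero_or_pos with rfl | hn
    · simpa using ihm
    rcases m.eq_zero_or_pos with rfl | hm
    · simpa using ihn
    exact one_add_X_pow_add_notMem hJ hn hm ihn ihm

theorem one_add_X_pow_add_X_pow_mem {J : Ideal (Polynomial 𝔹)} {p q : ℕ}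
    (hp : (1 : Polynomial 𝔹) + X ^ p ∈ J) (hq : (1 : Polynomial 𝔹) + X ^ q ∈ J) :
    (1 : Polynomial 𝔹) + X ^ p + X ^ q ∈ J := by
  have := J.add_mem hp hq
  rwa [add_add_add_comm, one_add_one_polynomial_boolSemiring, ← add_assoc] at this

theorem one_add_X_pow_add_X_pow_add_mem {J : Ideal (Polynomial 𝔹)} {p q : ℕ}
    (hq : (1 : Polynomial 𝔹) + X ^ q ∈ J)
    (h : (1 : Polynomial 𝔹) + X ^ p ∈ J ∨ (1 : Polynomial 𝔹) + X ^ (p + q) ∈ J) :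
    (1 : Polynomial 𝔹) + X ^ p + X ^ (p + q) ∈ J := by
  have hidem (z : Polynomial 𝔹) : z + z = z := by
    rw [← mul_one z, ← mul_add, one_add_one_polynomial_boolSemiring]
  have hpq := J.mul_mem_left (X ^ p) hq
  rw [mul_add, mul_one, ← pow_add] at hpq
  rcases h with h | h
  · have := J.add_mem h hpq
    rwa [← add_assoc, add_assoc 1, hidem] at this
  · have := J.add_mem h hpq
    rwa [add_add_add_comm, hidem] at this

theorem stmt_15 (J : Ideal (Polynomial 𝔹)) (hJ : J.IsPrime)
    (hx : (X : Polynomial 𝔹) ∉ J)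
    (hne : {n : ℕ | 1 ≤ n ∧ (1 : Polynomial 𝔹) + X ^ n ∉ J}.Nonempty)
    (d : ℕ) (hd : 1 < d)
    (hdvd : ∀ n : ℕ, 1 ≤ n → (1 : Polynomial 𝔹) + X ^ n ∉ J → d ∣ n)
    (hgcd : ∀ e : ℕ, (∀ n : ℕ, 1 ≤ n → (1 : Polynomial 𝔹) + X ^ n ∉ J → e ∣ n) → e ∣ d) :
    ∃ A : ℕ, 0 < A ∧ ∀ a ∈ AJ J, A < a →
      (∀ m : ℕ, 1 ≤ m → (1 : Polynomial 𝔹) + X ^ a + X ^ m ∈ J) ∧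
      (∀ m : ℕ, a < m → (1 : Polynomial 𝔹) + X ^ (m - a) + X ^ m ∈ J) := by
  obtain ⟨A, hA⟩ :=
    Nat.exists_mem_closure_of_ge {n : ℕ | 1 ≤ n ∧ (1 : Polynomial 𝔹) + X ^ n ∉ J}
  have hdvd_gcd := hgcd (Nat.setGcd {n : ℕ | 1 ≤ n ∧ (1 : Polynomial 𝔹) + X ^ n ∉ J})
    fun n hn hnJ => Nat.setGcd_dvd_of_mem ⟨hn, hnJ⟩
  have hmem (n : ℕ) (hn : ¬ d ∣ n) : (1 : Polynomial 𝔹) + X ^ n ∈ J := by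
    by_contra h
    exact hn (hdvd n (Nat.pos_of_ne_zero fun h0 => hn (h0 ▸ dvd_zero d)) h)
  refine ⟨A + 1, A.succ_pos, fun a ⟨_, haJ⟩ hAa => ?_⟩
  have hda : ¬ d ∣ a := fun h => one_add_X_pow_notMem_of_mem_closure hJ
    (hA a (by omega) (hdvd_gcd.trans h)) haJ
  refine ⟨fun m _ => ?_, fun m ham => ?_⟩
  · by_cases hm : d ∣ m
    · rcases Nat.le_total a m with h | h
      · obtain ⟨k, rfl⟩ := Nat.exists_eq_add_of_le h
        exact one_add_X_pow_add_X_pow_add_mem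
          (hmem k fun hk => hda ((Nat.dvd_add_left hk).mp hm)) (.inl haJ)
      · obtain ⟨k, rfl⟩ := Nat.exists_eq_add_of_le h
        rw [add_right_comm]
        exact one_add_X_pow_add_X_pow_add_mem (hmem k fun hk => hda (dvd_add hm hk)) (.inr haJ)
    · exact one_add_X_pow_add_X_pow_mem haJ (hmem m hm)
  · obtain ⟨k, rfl⟩ := Nat.exists_eq_add_of_le' ham.le
    rw [Nat.add_sub_cancel]
    refine one_add_X_pow_add_X_pow_add_mem haJ ?_
    by_cases hk : d ∣ k
    · exact .inr (hmem _ fun h => hda ((Nat.dvd_add_right hk).mp h))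
    · exact .inl (hmem k hk)
end
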